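/- SafeTab-P satisfies bounded zCDP with doubled budget: Let I be a domain of records. For each level i = 1, ..., ω, let g_i : I → 2^{P_i} assign records to groups with stability Δ(g_i) ≤ s_i, let ρ_i > 0, and suppose each group j ∈ P_i is designated either TotalOnly or adaptive. The SafeTab-P mechanism, on input database x, for each level i and each group j ∈ P_i with sub-multiset x_{i,j} of records r of x with j ∈ g_i(r), outputs: if j is TotalOnly, |x_{i,j}| + N_Z(s_i/(2ρ_i)) noise; otherwise, the two-stage adaptive tabulation mechanism with total budget ρ_i/s_i and split γ applied to x_{i,j}. All noise samples are independent. Then SafeTab-P satisfies bounded 2ρ_total-zCDP with ρ_total = Σ_{i=1}^{ω} ρ_i, where bounded means privacy with respect to bounded neighboring databases. -/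

import Mathlib

open scoped BigOperators ENNReal

/-- Rényi divergence of order `α` between two discrete distributions. -/
noncomputable def renyiDiv {β : Type*} (α : ℝ) (P Q : PMF β) : ℝ :=
  (α - 1)⁻¹ * Real.log (∑' b : β, (P b).toReal ^ α * (Q b).toReal ^ (1 - α))

/-- Two databases (multisets of records) are neighbors if their symmetric
difference contains exactly one record. -/
def Neighbor {I : Type*} [DecidableEq I] (x x' : Multiset I) : Prop :=
  ((x - x') + (x' - x)).card = 1

/-- A randomized mechanism `M` satisfies `ρ`-zCDP. -/
def zCDP {I β : Type*} [DecidableEq I] (M : Multiset I → PMF β) (ρ : ℝ) : Prop :=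
  ∀ x x' : Multiset I, Neighbor x x' → ∀ α : ℝ, 1 < α →
    renyiDiv α (M x) (M x') ≤ α * ρ

universe u

/-- Product of finitely many independent distributions, indexed by `Fin n`. -/
noncomputable def pmfPiFin : (n : ℕ) → (β : Fin n → Type u) →
    ((i : Fin n) → PMF (β i)) → PMF ((i : Fin n) → β i)
  | 0, _, _ => PMF.pure (fun i => i.elim0)
  | n + 1, β, p =>
      (p 0).bind fun b0 =>
        (pmfPiFin n (fun i => β i.succ) (fun i => p i.succ)).bind fun f =>
          PMF.pure (Fin.cons b0 f)

/-- Product of independent distributions indexed by a finite type. -/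
noncomputable def pmfPi {ι : Type*} [Fintype ι] {β : ι → Type*}
    (p : (i : ι) → PMF (β i)) : PMF ((i : ι) → β i) :=
  (pmfPiFin (Fintype.card ι) (fun k => β ((Fintype.equivFin ι).symm k))
      (fun k => p ((Fintype.equivFin ι).symm k))).map
    ⇑(Equiv.piCongrLeft' β (Fintype.equivFin ι)).symm

/-- Two databases are bounded neighbors if they are identical except that a single
record of one is replaced by a different record in the other (in particular they
contain the same number of records). -/
def BoundedNeighbor {I : Type*} (x x' : Multiset I) : Prop :=
  ∃ (z : Multiset I) (a b : I), a ≠ b ∧ x = a ::ₘ z ∧ x' = b ::ₘ z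

/-- A randomized mechanism `M` satisfies bounded `ρ`-zCDP. -/
def BoundedZCDP {I β : Type*} (M : Multiset I → PMF β) (ρ : ℝ) : Prop :=
  ∀ x x' : Multiset I, BoundedNeighbor x x' → ∀ α : ℝ, 1 < α →
    renyiDiv α (M x) (M x') ≤ α * ρ

open scoped ENNReal

/-- The (real-valued) unnormalized discrete Gaussian mass function. -/
noncomputable def dgaussMass (σ2 : ℝ) (y : ℤ) : ℝ :=
  Real.exp (-(y : ℝ) ^ 2 / (2 * σ2))

lemma dgaussMass_summable {σ2 : ℝ} (h : 0 < σ2) : Summable (dgaussMass σ2) := by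
  have h2 : (0 : ℝ) < 2 * σ2 := by linarith
  have hgeo : Summable fun n : ℕ => Real.exp ((n : ℝ) * (-(2 * σ2)⁻¹)) :=
    Real.summable_exp_nat_mul_iff.mpr (by rw [neg_lt_zero]; positivity)
  have hnat : Summable fun n : ℕ => dgaussMass σ2 (n : ℤ) := by
    apply Summable.of_nonneg_of_le (fun n => (Real.exp_pos _).le) ?_ hgeo
    intro n
    apply Real.exp_le_exp.mpr
    have hn : (n : ℝ) ≤ (n : ℝ) ^ 2 := by exact_mod_cast Nat.le_self_pow two_ne_zero n
    push_cast [dgaussMass]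
    rw [show (n : ℝ) * (-(2 * σ2)⁻¹) = -((n : ℝ) / (2 * σ2)) by ring,
      show -(n : ℝ) ^ 2 / (2 * σ2) = -((n : ℝ) ^ 2 / (2 * σ2)) by ring]
    apply neg_le_neg
    gcongr
  apply Summable.of_nat_of_neg hnat
  have : ∀ n : ℕ, dgaussMass σ2 (-(n : ℤ)) = dgaussMass σ2 (n : ℤ) := by
    intro n; simp [dgaussMass]
  simpa only [this] using hnat

lemma dgaussMass_pos (σ2 : ℝ) (y : ℤ) : 0 < dgaussMass σ2 y := Real.exp_pos _

lemma dgaussMass_tsum_pos {σ2 : ℝ} (h : 0 < σ2) : 0 < ∑' y : ℤ, dgaussMass σ2 y :=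
  Summable.tsum_pos (dgaussMass_summable h) (fun y => (dgaussMass_pos σ2 y).le) 0 (dgaussMass_pos σ2 0)

/-- The discrete Gaussian distribution `N_ℤ(σ²)` centered at `0`, as a `PMF` on `ℤ`
(defined to be a point mass when `σ² ≤ 0`). -/
noncomputable def dgaussPMF (σ2 : ℝ) : PMF ℤ :=
  if h : 0 < σ2 then
    ⟨fun x => ENNReal.ofReal (dgaussMass σ2 x / ∑' y : ℤ, dgaussMass σ2 y), by
      have hS : (0 : ℝ) < ∑' y : ℤ, dgaussMass σ2 y := dgaussMass_tsum_pos h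
      have key : ∑' x : ℤ, ENNReal.ofReal (dgaussMass σ2 x / ∑' y : ℤ, dgaussMass σ2 y) = 1 := by
        rw [← ENNReal.ofReal_tsum_of_nonneg (fun x => div_nonneg (dgaussMass_pos σ2 x).le hS.le)
          ((dgaussMass_summable h).div_const _), tsum_div_const, div_self hS.ne',
          ENNReal.ofReal_one]
      exact key ▸ ENNReal.summable.hasSum⟩
  else PMF.pure 0

/-- The two-stage adaptive tabulation mechanism with budget `ρ` and split `γ`:
first release a noisy total count `y0` of the database using discrete Gaussian noise of
variance `1/(2γρ)`; then, depending on which of the thresholds `Θ1 ≤ Θ2 ≤ Θ3` the noisy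
count exceeds, select one of four fixed partitions of the record domain (partition `t`
has `n t` cells, given by `part t : I → Fin (n t)`) and release all of its cell counts,
each perturbed by independent discrete Gaussian noise of variance `1/(2(1-γ)ρ)`. -/
noncomputable def twoStage {I : Type*} (n : Fin 4 → ℕ) (part : (t : Fin 4) → I → Fin (n t))
    (Θ1 Θ2 Θ3 : ℤ) (ρ γ : ℝ) (x : Multiset I) :
    PMF (ℤ × Σ t : Fin 4, (Fin (n t) → ℤ)) :=
  (dgaussPMF (1 / (2 * γ * ρ))).bind fun z0 =>
    let y0 : ℤ := (Multiset.card x : ℤ) + z0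
    let t : Fin 4 := if y0 < Θ1 then 0 else if y0 < Θ2 then 1 else if y0 < Θ3 then 2 else 3
    (pmfPi fun _ : Fin (n t) => dgaussPMF (1 / (2 * (1 - γ) * ρ))).bind fun noise =>
      PMF.pure (y0, ⟨t, fun c => ((x.filter fun r => part t r = c).card : ℤ) + noise c⟩)

/-- The SafeTab-P mechanism. For each population-group level `i` and each group `j : P i`,
let `x_{i,j}` be the sub-multiset of records `r` of `x` with `j ∈ g i r`. If `j` is a
TotalOnly group, release the count of `x_{i,j}` perturbed by discrete Gaussian noise of
variance `s i / (2 ρ i)`; otherwise apply the two-stage adaptive tabulation mechanism with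
total budget `ρ i / s i` and split `γ` to `x_{i,j}`. All noise is independent. -/
noncomputable def safeTabP {I : Type*} [DecidableEq I] {ω : ℕ}
    (P : Fin ω → Type*) [∀ i, Fintype (P i)] [∀ i, DecidableEq (P i)]
    (g : (i : Fin ω) → I → Finset (P i)) (s : Fin ω → ℕ) (ρ : Fin ω → ℝ) (γ : ℝ)
    (TotalOnly : (i : Fin ω) → P i → Prop) [∀ i, DecidablePred (TotalOnly i)]
    (nCells : (i : Fin ω) → P i → Fin 4 → ℕ)
    (part : (i : Fin ω) → (j : P i) → (t : Fin 4) → I → Fin (nCells i j t))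
    (Θ1 Θ2 Θ3 : (i : Fin ω) → P i → ℤ) (x : Multiset I) :
    PMF ((i : Fin ω) → (j : P i) → (ℤ ⊕ (ℤ × Σ t : Fin 4, (Fin (nCells i j t) → ℤ)))) :=
  pmfPi fun i => pmfPi fun j =>
    let xij := x.filter fun r => j ∈ g i r
    if TotalOnly i j then
      (dgaussPMF ((s i : ℝ) / (2 * ρ i))).map
        (fun zn => Sum.inl ((Multiset.card xij : ℤ) + zn))
    else
      (twoStage (nCells i j) (part i j) (Θ1 i j) (Θ2 i j) (Θ3 i j)
        (ρ i / (s i : ℝ)) γ xij).map Sum.inr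

lemma shifted_summable {σ2 : ℝ} (h : 0 < σ2) (c : ℝ) :
    Summable fun y : ℤ => Real.exp (-((y : ℝ) - c) ^ 2 / (2 * σ2)) := by
  have h2 : 0 < 2 * σ2 := by linarith
  refine Summable.of_nonneg_of_le (fun _ => (Real.exp_pos _).le) ?_
    ((dgaussMass_summable h2).mul_left (Real.exp (c ^ 2 / (2 * σ2))))
  intro y
  rw [dgaussMass, ← Real.exp_add]
  apply Real.exp_le_exp.mpr
  have : c ^ 2 / (2 * σ2) + -(y : ℝ) ^ 2 / (2 * (2 * σ2)) - (-((y : ℝ) - c) ^ 2 / (2 * σ2))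
      = ((y : ℝ) - 2 * c) ^ 2 / (4 * σ2) := by
    field_simp
    ring
  have h3 : 0 ≤ ((y : ℝ) - 2 * c) ^ 2 / (4 * σ2) := by positivity
  linarith

lemma shifted_tsum_le {σ2 : ℝ} (h : 0 < σ2) (c : ℝ) :
    ∑' y : ℤ, Real.exp (-((y : ℝ) - c) ^ 2 / (2 * σ2)) ≤ ∑' y : ℤ, dgaussMass σ2 y := by
  have hpi := Real.pi_pos
  set a : ℝ := 2 * Real.pi * σ2 with ha
  have hapos : 0 < a := by positivity
  have key : ∀ c : ℝ, ∑' n : ℤ, Complex.exp (-Real.pi * (a : ℂ) * n ^ 2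
        + 2 * Real.pi * (Complex.I * c) * n) =
      1 / (a : ℂ) ^ (1 / 2 : ℂ) *
        ((∑' y : ℤ, Real.exp (-((y : ℝ) - c) ^ 2 / (2 * σ2)) : ℝ) : ℂ) := by
    intro c
    rw [Complex.tsum_exp_neg_quadratic (by simpa using hapos) (Complex.I * c), Complex.ofReal_tsum]
    congr 1
    apply tsum_congr
    intro n
    rw [Complex.ofReal_exp]
    congr 1
    have : (n : ℂ) + Complex.I * (Complex.I * c) = n - c := by
      rw [← mul_assoc, Complex.I_mul_I]; ring
    rw [this, ha]
    push_cast
    have h1 : (Real.pi : ℂ) ≠ 0 := by exact_mod_cast hpi.ne'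
    have h2 : (σ2 : ℂ) ≠ 0 := by exact_mod_cast h.ne'
    field_simp
  have hsum : Summable fun n : ℤ => Real.exp (-Real.pi * a * n ^ 2) := by
    have h3 : 0 < 1 / (2 * Real.pi * a) := by positivity
    refine (dgaussMass_summable h3).congr ?_
    intro n
    rw [dgaussMass]
    congr 1
    field_simp
  have hnorm : ∀ (c : ℝ) (n : ℤ), ‖Complex.exp (-Real.pi * (a : ℂ) * n ^ 2
        + 2 * Real.pi * (Complex.I * c) * n)‖ = Real.exp (-Real.pi * a * n ^ 2) := by
    intro c n
    rw [Complex.norm_exp]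
    congr 1
    have : (-Real.pi * (a : ℂ) * n ^ 2 + 2 * Real.pi * (Complex.I * c) * n)
      = ((-Real.pi * a * n ^ 2 : ℝ) : ℂ) + ((2 * Real.pi * c * n : ℝ) : ℂ) * Complex.I := by
      push_cast; ring
    rw [this, Complex.add_re, Complex.ofReal_re, Complex.re_ofReal_mul, Complex.I_re]
    ring
  have h0 := key 0
  have h0' : ∑' n : ℤ, Complex.exp (-Real.pi * (a : ℂ) * n ^ 2
        + 2 * Real.pi * (Complex.I * (0 : ℝ)) * n) = ((∑' n : ℤ, Real.exp (-Real.pi * a * n ^ 2) : ℝ) : ℂ) := by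
    rw [Complex.ofReal_tsum]
    apply tsum_congr
    intro n
    push_cast
    congr 1
    ring
  have hc := key c
  have hle : ‖∑' n : ℤ, Complex.exp (-Real.pi * (a : ℂ) * n ^ 2
        + 2 * Real.pi * (Complex.I * c) * n)‖ ≤ ∑' n : ℤ, Real.exp (-Real.pi * a * n ^ 2) := by
    refine (norm_tsum_le_tsum_norm ?_).trans_eq ?_
    · simpa only [hnorm] using hsum
    · simp only [hnorm]
  have hle2 : ‖∑' n : ℤ, Complex.exp (-Real.pi * (a : ℂ) * n ^ 2
        + 2 * Real.pi * (Complex.I * c) * n)‖ ≤ ‖∑' n : ℤ, Complex.exp (-Real.pi * (a : ℂ) * n ^ 2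
        + 2 * Real.pi * (Complex.I * (0 : ℝ)) * n)‖ := by
    refine hle.trans ?_
    rw [h0', Complex.norm_real]
    exact le_abs_self _
  rw [h0, hc, norm_mul, norm_mul] at hle2
  have hpos : 0 < ‖1 / (a : ℂ) ^ (1 / 2 : ℂ)‖ := by
    rw [norm_pos_iff]
    have : (a : ℂ) ≠ 0 := by exact_mod_cast hapos.ne'
    simp [Complex.cpow_eq_zero_iff, this]
  have h5 := le_of_mul_le_mul_left hle2 hpos
  rw [Complex.norm_real, Complex.norm_real, Real.norm_eq_abs, Real.norm_eq_abs,
    abs_of_nonneg (tsum_nonneg fun _ => (Real.exp_pos _).le),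
    abs_of_nonneg (tsum_nonneg fun _ => (Real.exp_pos _).le)] at h5
  simpa [dgaussMass] using h5

/-- Extended-nonnegative-real Rényi moment. -/
noncomputable def renyiMom {β : Type*} (α : ℝ) (P Q : PMF β) : ℝ≥0∞ :=
  ∑' b : β, P b ^ α * Q b ^ (1 - α)

/-- The bound. -/
noncomputable def eBd (α e : ℝ) : ℝ≥0∞ := ENNReal.ofReal (Real.exp (α * (α - 1) * e))

lemma eBd_add (α e f : ℝ) : eBd α (e + f) = eBd α e * eBd α f := by
  rw [eBd, eBd, eBd, ← ENNReal.ofReal_mul (Real.exp_pos _).le, ← Real.exp_add]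
  ring_nf

lemma eBd_zero (α : ℝ) : eBd α 0 = 1 := by simp [eBd]

lemma eBd_sum {ι : Type*} (s : Finset ι) (α : ℝ) (e : ι → ℝ) :
    ∏ i ∈ s, eBd α (e i) = eBd α (∑ i ∈ s, e i) := by
  classical
  induction s using Finset.induction_on with
  | empty => simp [eBd_zero]
  | insert i s hi ih => rw [Finset.prod_insert hi, Finset.sum_insert hi, eBd_add, ih]

lemma eBd_mono {α e f : ℝ} (hα : 1 < α) (h : e ≤ f) : eBd α e ≤ eBd α f := by
  apply ENNReal.ofReal_le_ofReal
  apply Real.exp_le_exp.mpr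
  have : 0 ≤ α * (α - 1) := mul_nonneg (by linarith) (by linarith)
  exact mul_le_mul_of_nonneg_left h this

lemma renyiDiv_le {β : Type*} {α e : ℝ} (hα : 1 < α) (he : 0 ≤ e) (P Q : PMF β)
    (h : renyiMom α P Q ≤ eBd α e) : renyiDiv α P Q ≤ α * e := by
  have htop : renyiMom α P Q ≠ ⊤ := ne_top_of_le_ne_top ENNReal.ofReal_ne_top h
  have heq : ∑' b : β, (P b).toReal ^ α * (Q b).toReal ^ (1 - α) = (renyiMom α P Q).toReal := by
    rw [renyiMom, ENNReal.tsum_toReal_eq (fun b => ENNReal.ne_top_of_tsum_ne_top htop b)]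
    apply tsum_congr
    intro b
    rw [ENNReal.toReal_mul, ENNReal.toReal_rpow, ENNReal.toReal_rpow]
  have h1 : (renyiMom α P Q).toReal ≤ Real.exp (α * (α - 1) * e) := by
    rw [← ENNReal.toReal_ofReal (Real.exp_pos (α * (α - 1) * e)).le]
    exact ENNReal.toReal_mono ENNReal.ofReal_ne_top h
  have hα1 : 0 < α - 1 := by linarith
  have h2 : Real.log (renyiMom α P Q).toReal ≤ α * (α - 1) * e := by
    rcases eq_or_lt_of_le (ENNReal.toReal_nonneg (a := renyiMom α P Q)) with h0 | h0
    · rw [← h0, Real.log_zero]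
      exact mul_nonneg (mul_nonneg (by linarith) hα1.le) he
    · exact (Real.log_le_iff_le_exp h0).mpr h1
  rw [renyiDiv, heq, inv_mul_le_iff₀ hα1]
  linarith

lemma map_apply_inj {β δ : Type*} (P : PMF β) (f : β → δ) (hf : Function.Injective f) (b : β) :
    P.map f (f b) = P b := by
  classical
  rw [PMF.map_apply, tsum_eq_single b]
  · simp
  · intro b' hb'
    rw [if_neg]
    intro h
    exact hb' (hf h).symm

lemma renyiMom_map {β δ : Type*} {α : ℝ} (hα : 1 < α) (P Q : PMF β) (f : β → δ)
    (hf : Function.Injective f) :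
    renyiMom α (P.map f) (Q.map f) = renyiMom α P Q := by
  classical
  rw [renyiMom, renyiMom, ← hf.tsum_eq]
  · apply tsum_congr
    intro b
    rw [map_apply_inj _ _ hf, map_apply_inj _ _ hf]
  · intro d hd
    by_contra hnd
    apply hd
    have : P.map f d = 0 := by
      rw [PMF.map_apply]
      simp only [ENNReal.tsum_eq_zero]
      intro b
      rw [if_neg]
      rintro rfl
      exact hnd ⟨b, rfl⟩
    simp only [this]
    rw [ENNReal.zero_rpow_of_pos (by linarith), zero_mul]

lemma chain_apply {β δ : Type*} (P : PMF β) (K : β → PMF δ) (b : β) (d : δ) :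
    (P.bind fun y => (K y).map (Prod.mk y)) (b, d) = P b * K b d := by
  classical
  rw [PMF.bind_apply, tsum_eq_single b]
  · rw [map_apply_inj _ _ (Prod.mk_right_injective b)]
  · intro b' hb'
    have : (K b').map (Prod.mk b') (b, d) = 0 := by
      rw [PMF.map_apply]
      simp only [ENNReal.tsum_eq_zero]
      intro w
      rw [if_neg]
      intro h
      exact hb' (congrArg Prod.fst h).symm
    rw [this, mul_zero]

lemma renyiMom_chain {β δ : Type*} {α : ℝ} (hα : 1 < α) (P Q : PMF β) (K L : β → PMF δ)
    (C : ℝ≥0∞) (h : ∀ b, renyiMom α (K b) (L b) ≤ C) :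
    renyiMom α (P.bind fun y => (K y).map (Prod.mk y)) (Q.bind fun y => (L y).map (Prod.mk y))
      ≤ renyiMom α P Q * C := by
  rw [renyiMom, ENNReal.tsum_prod', renyiMom, ← ENNReal.tsum_mul_right]
  apply ENNReal.tsum_le_tsum
  intro b
  refine le_trans (le_of_eq ?_) (mul_le_mul_right (h b) _)
  rw [renyiMom, ← ENNReal.tsum_mul_left]
  apply tsum_congr
  intro d
  rw [chain_apply, chain_apply, ENNReal.mul_rpow_of_nonneg _ _ (by linarith),
    ENNReal.mul_rpow_of_ne_top (PMF.apply_ne_top _ _) (PMF.apply_ne_top _ _)]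
  ring

lemma pmfPiFin_succ (n : ℕ) (β : Fin (n + 1) → Type u) (p : (i : Fin (n + 1)) → PMF (β i)) :
    pmfPiFin (n + 1) β p = ((p 0).bind fun b =>
      (pmfPiFin n (fun i => β i.succ) (fun i => p i.succ)).map (Prod.mk b)).map
        (Fin.consEquiv β) := by
  rw [pmfPiFin, PMF.map_bind]
  congr 1
  funext b
  rw [PMF.map_comp]
  rfl

lemma renyiMom_pmfPiFin {α : ℝ} (hα : 1 < α) : ∀ (n : ℕ) (β : Fin n → Type u)
    (p q : (i : Fin n) → PMF (β i)),
    renyiMom α (pmfPiFin n β p) (pmfPiFin n β q) ≤ ∏ i, renyiMom α (p i) (q i)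
  | 0, β, p, q => by
      classical
      rw [renyiMom, pmfPiFin, pmfPiFin, tsum_eq_single (fun i => i.elim0)]
      · simp
      · intro b hb
        exact absurd (funext fun i => i.elim0) hb
  | n + 1, β, p, q => by
      rw [pmfPiFin_succ, pmfPiFin_succ, renyiMom_map hα _ _ _ (Equiv.injective _),
        Fin.prod_univ_succ]
      exact renyiMom_chain hα _ _ _ _ _ fun b => renyiMom_pmfPiFin hα n _ _ _

lemma renyiMom_pmfPi {α : ℝ} (hα : 1 < α) {ι : Type*} [Fintype ι] {β : ι → Type*}
    (p q : (i : ι) → PMF (β i)) :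
    renyiMom α (pmfPi p) (pmfPi q) ≤ ∏ i, renyiMom α (p i) (q i) := by
  rw [pmfPi, pmfPi, renyiMom_map hα _ _ _ (Equiv.injective _)]
  refine (renyiMom_pmfPiFin hα _ _ _ _).trans_eq ?_
  exact Equiv.prod_comp (Fintype.equivFin ι).symm (fun i => renyiMom α (p i) (q i))

lemma pmfPiFin_map : ∀ (n : ℕ) (β δ : Fin n → Type u)
    (p : (i : Fin n) → PMF (β i)) (h : (i : Fin n) → β i → δ i),
    pmfPiFin n δ (fun i => (p i).map (h i)) = (pmfPiFin n β p).map (fun f i => h i (f i))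
  | 0, β, δ, p, h => by
      rw [pmfPiFin, pmfPiFin, PMF.pure_map]
      congr 1
      funext i
      exact i.elim0
  | n + 1, β, δ, p, h => by
      rw [pmfPiFin, pmfPiFin, pmfPiFin_map n (fun i => β i.succ) (fun i => δ i.succ)
        (fun i => p i.succ) (fun i => h i.succ), PMF.bind_map, PMF.map_bind]
      congr 1
      funext b
      simp only [Function.comp]
      rw [PMF.bind_map, PMF.map_bind]
      congr 1
      funext f
      rw [PMF.pure_map]
      simp only [Function.comp]
      congr 1
      funext i
      refine Fin.cases ?_ (fun i => ?_) i <;> simp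

lemma pmfPi_map {ι : Type*} [Fintype ι] {β δ : ι → Type u}
    (p : (i : ι) → PMF (β i)) (h : (i : ι) → β i → δ i) :
    pmfPi (fun i => (p i).map (h i)) = (pmfPi p).map (fun f i => h i (f i)) := by
  rw [pmfPi, pmfPi, pmfPiFin_map _ _ _ (fun k => p ((Fintype.equivFin ι).symm k))
    (fun k => h ((Fintype.equivFin ι).symm k)), PMF.map_comp, PMF.map_comp]
  congr 1
  funext f
  simp only [Function.comp]
  rw [Equiv.symm_apply_eq]
  funext k
  exact congrArg (h ((Fintype.equivFin ι).symm k))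
    (congrFun ((Equiv.piCongrLeft' β (Fintype.equivFin ι)).apply_symm_apply f) k).symm

lemma dgauss_shift_apply {σ2 : ℝ} (h : 0 < σ2) (a y : ℤ) :
    (dgaussPMF σ2).map (fun z => a + z) y
      = ENNReal.ofReal (dgaussMass σ2 (y - a) / ∑' y : ℤ, dgaussMass σ2 y) := by
  have h1 := map_apply_inj (dgaussPMF σ2) (fun z => a + z) (add_right_injective a) (y - a)
  simp only [add_sub_cancel] at h1
  have h2 : ∀ w, dgaussPMF σ2 w
      = ENNReal.ofReal (dgaussMass σ2 w / ∑' y : ℤ, dgaussMass σ2 y) := by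
    intro w
    have h3 : dgaussPMF σ2 = _ := dif_pos h
    rw [h3]
    rfl
  rw [h1, h2]

lemma renyiMom_dgauss {α σ2 : ℝ} (h : 0 < σ2) (a b : ℤ) :
    renyiMom α ((dgaussPMF σ2).map (fun z => a + z)) ((dgaussPMF σ2).map (fun z => b + z))
      ≤ eBd α (((a : ℝ) - b) ^ 2 * (1 / (2 * σ2))) := by
  have hZ := dgaussMass_tsum_pos h
  have hT := shifted_tsum_le h (α * a + (1 - α) * b)
  have hS := shifted_summable h (α * a + (1 - α) * b)
  rw [renyiMom]
  simp only [dgauss_shift_apply h]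
  set Z := ∑' y : ℤ, dgaussMass σ2 y with hZdef
  have hterm : ∀ y : ℤ, ENNReal.ofReal (dgaussMass σ2 (y - a) / Z) ^ α *
      ENNReal.ofReal (dgaussMass σ2 (y - b) / Z) ^ (1 - α) =
      ENNReal.ofReal ((Real.exp (α * (α - 1) * (((a : ℝ) - b) ^ 2 * (1 / (2 * σ2)))) / Z) *
        Real.exp (-((y : ℝ) - (α * a + (1 - α) * b)) ^ 2 / (2 * σ2))) := by
    intro y
    have hp := dgaussMass_pos σ2 (y - a)
    have hq := dgaussMass_pos σ2 (y - b)
    rw [ENNReal.ofReal_rpow_of_pos (div_pos hp hZ), ENNReal.ofReal_rpow_of_pos (div_pos hq hZ),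
      ← ENNReal.ofReal_mul (Real.rpow_nonneg (div_pos hp hZ).le _),
      Real.div_rpow hp.le hZ.le, Real.div_rpow hq.le hZ.le, div_mul_div_comm, ← Real.rpow_add hZ,
      dgaussMass, dgaussMass, ← Real.exp_mul, ← Real.exp_mul, ← Real.exp_add,
      div_mul_eq_mul_div (Real.exp (α * (α - 1) * _)), ← Real.exp_add]
    congr 2
    · congr 1
      push_cast
      field_simp
      ring
    · rw [add_sub_cancel, Real.rpow_one]
  simp only [hterm]
  rw [← ENNReal.ofReal_tsum_of_nonneg _ (hS.mul_left _), tsum_mul_left, eBd]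
  · apply ENNReal.ofReal_le_ofReal
    rw [div_mul_eq_mul_div, div_le_iff₀ hZ]
    exact mul_le_mul_of_nonneg_left hT (Real.exp_pos _).le
  · intro y
    positivity

/-- The threshold selection. -/
def thrSel (Θ1 Θ2 Θ3 y0 : ℤ) : Fin 4 :=
  if y0 < Θ1 then 0 else if y0 < Θ2 then 1 else if y0 < Θ3 then 2 else 3

/-- Second stage kernel. -/
noncomputable def stage2 {I : Type*} (n : Fin 4 → ℕ) (part : (t : Fin 4) → I → Fin (n t))
    (σ2 : ℝ) (x : Multiset I) (t : Fin 4) : PMF (Σ t : Fin 4, (Fin (n t) → ℤ)) :=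
  (pmfPi fun c : Fin (n t) => (dgaussPMF σ2).map
    (fun z => ((x.filter fun r => part t r = c).card : ℤ) + z)).map (Sigma.mk t)

lemma twoStage_eq {I : Type*} (n : Fin 4 → ℕ) (part : (t : Fin 4) → I → Fin (n t))
    (Θ1 Θ2 Θ3 : ℤ) (ρ γ : ℝ) (x : Multiset I) :
    twoStage n part Θ1 Θ2 Θ3 ρ γ x =
      ((dgaussPMF (1 / (2 * γ * ρ))).map (fun z => (Multiset.card x : ℤ) + z)).bind fun y =>
        (stage2 n part (1 / (2 * (1 - γ) * ρ)) x (thrSel Θ1 Θ2 Θ3 y)).map (Prod.mk y) := by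
  rw [PMF.bind_map, twoStage]
  congr 1
  funext z
  simp only [Function.comp, stage2]
  rw [pmfPi_map, PMF.map_comp, PMF.map_comp]
  rfl

lemma renyiMom_twoStage {I : Type*} {α : ℝ} (hα : 1 < α) (n : Fin 4 → ℕ)
    (part : (t : Fin 4) → I → Fin (n t))
    (Θ1 Θ2 Θ3 : ℤ) {ρ γ : ℝ} (hρ : 0 < ρ) (hγ0 : 0 < γ) (hγ1 : γ < 1) (x x' : Multiset I)
    (k : ℝ) (h1 : ((x.card : ℝ) - x'.card) ^ 2 ≤ k)
    (h2 : ∀ t, ∑ c, (((x.filter fun r => part t r = c).card : ℝ)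
      - ((x'.filter fun r => part t r = c).card : ℝ)) ^ 2 ≤ k) :
    renyiMom α (twoStage n part Θ1 Θ2 Θ3 ρ γ x) (twoStage n part Θ1 Θ2 Θ3 ρ γ x')
      ≤ eBd α (k * ρ) := by
  have hγ' : 0 < 1 - γ := by linarith
  rw [twoStage_eq, twoStage_eq]
  refine (renyiMom_chain hα _ _ _ _ (eBd α (k * ((1 - γ) * ρ))) ?_).trans ?_
  · intro y
    rw [stage2, stage2, renyiMom_map hα _ _ _ sigma_mk_injective]
    refine (renyiMom_pmfPi hα _ _).trans ?_
    refine (Finset.prod_le_prod' fun c _ => renyiMom_dgauss (by positivity) _ _).trans ?_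
    rw [eBd_sum, ← Finset.sum_mul]
    apply eBd_mono hα
    have : 1 / (2 * (1 / (2 * (1 - γ) * ρ))) = (1 - γ) * ρ := by field_simp
    rw [this]
    have h3 := h2 (thrSel Θ1 Θ2 Θ3 y)
    push_cast
    exact mul_le_mul_of_nonneg_right h3 (by positivity)
  · have : k * ρ = k * (γ * ρ) + k * ((1 - γ) * ρ) := by ring
    rw [this, eBd_add]
    gcongr
    refine (renyiMom_dgauss (by positivity) _ _).trans ?_
    apply eBd_mono hα
    have : 1 / (2 * (1 / (2 * γ * ρ))) = γ * ρ := by field_simp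
    rw [this]
    push_cast
    exact mul_le_mul_of_nonneg_right h1 (by positivity)

lemma ind_sq (p q : Prop) [Decidable p] [Decidable q] :
    (((if p then 1 else 0 : ℝ)) - (if q then 1 else 0)) ^ 2
      ≤ (if p then 1 else 0) + (if q then 1 else 0) := by
  split_ifs <;> norm_num

lemma card_filter_cons {I : Type*} (p : I → Prop) [DecidablePred p] (a : I) (z : Multiset I) :
    (((a ::ₘ z).filter p).card : ℝ) = (if p a then 1 else 0) + ((z.filter p).card : ℝ) := by
  rw [Multiset.filter_cons]
  split_ifs <;> simp [add_comm]

/-- SafeTab-P satisfies bounded `2·ρ_total`-zCDP, where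
`ρ_total = ∑ i, ρ i`, provided each flatmap `g i` has stability at most `s i`. -/
theorem safeTabP_bounded_zCDP {I : Type*} [DecidableEq I] {ω : ℕ}
    (P : Fin ω → Type*) [∀ i, Fintype (P i)] [∀ i, DecidableEq (P i)]
    (g : (i : Fin ω) → I → Finset (P i))
    (s : Fin ω → ℕ) (hs : ∀ i, 0 < s i)
    (hstab : ∀ i (r : I), (g i r).card ≤ s i)
    (ρ : Fin ω → ℝ) (hρ : ∀ i, 0 < ρ i)
    (γ : ℝ) (hγ0 : 0 < γ) (hγ1 : γ < 1)
    (TotalOnly : (i : Fin ω) → P i → Prop) [∀ i, DecidablePred (TotalOnly i)]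
    (nCells : (i : Fin ω) → P i → Fin 4 → ℕ)
    (part : (i : Fin ω) → (j : P i) → (t : Fin 4) → I → Fin (nCells i j t))
    (Θ1 Θ2 Θ3 : (i : Fin ω) → P i → ℤ) :
    BoundedZCDP (safeTabP P g s ρ γ TotalOnly nCells part Θ1 Θ2 Θ3) (2 * ∑ i, ρ i) := by
  rintro x x' ⟨z, a, b, -, rfl, rfl⟩ α hα
  have hsum : 0 ≤ ∑ i, ρ i := Finset.sum_nonneg fun i _ => (hρ i).le
  apply renyiDiv_le hα (by linarith)
  rw [safeTabP, safeTabP]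
  refine (renyiMom_pmfPi hα _ _).trans ?_
  rw [Finset.mul_sum, ← eBd_sum]
  refine Finset.prod_le_prod' fun i _ => ?_
  refine (renyiMom_pmfPi hα _ _).trans ?_
  have hsi : (0 : ℝ) < s i := by exact_mod_cast hs i
  have hri : 0 < ρ i / (s i : ℝ) := div_pos (hρ i) hsi
  have hj : ∀ j : P i, renyiMom α
      (if TotalOnly i j then
        (dgaussPMF ((s i : ℝ) / (2 * ρ i))).map
          (fun zn => Sum.inl ((Multiset.card ((a ::ₘ z).filter fun r => j ∈ g i r) : ℤ) + zn))
      else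
        (twoStage (nCells i j) (part i j) (Θ1 i j) (Θ2 i j) (Θ3 i j)
          (ρ i / (s i : ℝ)) γ ((a ::ₘ z).filter fun r => j ∈ g i r)).map Sum.inr)
      (if TotalOnly i j then
        (dgaussPMF ((s i : ℝ) / (2 * ρ i))).map
          (fun zn => Sum.inl ((Multiset.card ((b ::ₘ z).filter fun r => j ∈ g i r) : ℤ) + zn))
      else
        (twoStage (nCells i j) (part i j) (Θ1 i j) (Θ2 i j) (Θ3 i j)
          (ρ i / (s i : ℝ)) γ ((b ::ₘ z).filter fun r => j ∈ g i r)).map Sum.inr)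
      ≤ eBd α (((if j ∈ g i a then 1 else 0) + (if j ∈ g i b then 1 else 0)) * (ρ i / s i)) := by
    intro j
    have hcard : (((((a ::ₘ z).filter fun r => j ∈ g i r).card : ℝ))
        - (((b ::ₘ z).filter fun r => j ∈ g i r).card : ℝ)) ^ 2
        ≤ (if j ∈ g i a then 1 else 0) + (if j ∈ g i b then 1 else 0) := by
      rw [card_filter_cons, card_filter_cons, add_sub_add_right_eq_sub]
      exact ind_sq _ _
    by_cases hT : TotalOnly i j
    · rw [if_pos hT, if_pos hT]
      have hmap : ∀ m : ℤ, (dgaussPMF ((s i : ℝ) / (2 * ρ i))).map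
          (fun zn => (Sum.inl (m + zn) : ℤ ⊕ (ℤ × Σ t : Fin 4, (Fin (nCells i j t) → ℤ)))) =
          ((dgaussPMF ((s i : ℝ) / (2 * ρ i))).map (fun zn => m + zn)).map Sum.inl := by
        intro m
        rw [PMF.map_comp]
        rfl
      rw [hmap, hmap, renyiMom_map hα _ _ _ Sum.inl_injective]
      have hri' := hρ i
      refine (renyiMom_dgauss (by positivity) _ _).trans ?_
      apply eBd_mono hα
      have : 1 / (2 * ((s i : ℝ) / (2 * ρ i))) = ρ i / s i := by field_simp
      rw [this]
      push_cast
      exact mul_le_mul_of_nonneg_right hcard hri.le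
    · rw [if_neg hT, if_neg hT, renyiMom_map hα _ _ _ Sum.inr_injective]
      refine renyiMom_twoStage hα _ _ _ _ _ hri hγ0 hγ1 _ _ _ hcard ?_
      intro t
      have hrw : ∀ (r : I), ∑ c, (if part i j t r = c ∧ j ∈ g i r then (1 : ℝ) else 0)
          = if j ∈ g i r then 1 else 0 := by
        intro r
        by_cases h : j ∈ g i r <;> simp [h]
      rw [← hrw a, ← hrw b, ← Finset.sum_add_distrib]
      refine Finset.sum_le_sum fun c _ => ?_
      rw [Multiset.filter_filter, Multiset.filter_filter, card_filter_cons, card_filter_cons,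
        add_sub_add_right_eq_sub]
      exact ind_sq _ _
  refine (Finset.prod_le_prod' fun j _ => hj j).trans ?_
  rw [eBd_sum, ← Finset.sum_mul]
  apply eBd_mono hα
  have hc : ∀ r : I, ∑ j : P i, (if j ∈ g i r then (1 : ℝ) else 0) ≤ s i := by
    intro r
    rw [Finset.sum_ite_mem, Finset.univ_inter, Finset.sum_const, nsmul_eq_mul, mul_one]
    exact_mod_cast hstab i r
  rw [Finset.sum_add_distrib]
  have h1 := add_le_add (hc a) (hc b)
  calc _ ≤ ((s i : ℝ) + s i) * (ρ i / s i) := mul_le_mul_of_nonneg_right h1 hri.le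
    _ = 2 * ρ i := by field_simp; ring
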